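/- Assume that η(C_m ⊕ C_n) = 2m + n − 2 for all positive integers m ∣ n. Then for every prime p and every positive integer α, one has t(C_{p^α} ⊕ C_{p^α}) = 3p^α − 2 = η(C_{p^α} ⊕ C_{p^α}). -/

import Mathlib

open Multiset Finset

/-- The cross number of a sequence (multiset) over an additive group:
    the sum of the reciprocals of the orders of its elements. -/
noncomputable def crossNum {G : Type*} [AddCommGroup G] (S : Multiset G) : ℝ :=
  (S.map fun g => (1 : ℝ) / (addOrderOf g : ℝ)).sum

/-- A tiny zero-sum sequence: non-empty, zero sum, cross number at most 1. -/
def IsTinyZS {G : Type*} [AddCommGroup G] (S' : Multiset G) : Prop :=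
  S' ≠ 0 ∧ S'.sum = 0 ∧ crossNum S' ≤ 1

/-- `tC G` : the smallest `t ≥ 1` such that every sequence over `G` of length `≥ t`
    contains a tiny zero-sum subsequence. -/
noncomputable def tC (G : Type*) [AddCommGroup G] : ℕ :=
  sInf {t : ℕ | 0 < t ∧ ∀ S : Multiset G, t ≤ Multiset.card S → ∃ S' ≤ S, IsTinyZS S'}

/-- `etaC G` : the smallest `t ≥ 1` such that every sequence over `G` of length `≥ t`
    contains a non-empty zero-sum subsequence of length at most `exp(G)`. -/
noncomputable def etaC (G : Type*) [AddCommGroup G] : ℕ :=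
  sInf {t : ℕ | 0 < t ∧ ∀ S : Multiset G, t ≤ Multiset.card S →
    ∃ S' ≤ S, S' ≠ 0 ∧ S'.sum = 0 ∧ Multiset.card S' ≤ AddMonoid.exponent G}

/-- `etaDD G d' d` : the smallest `t ≥ 1` such that every sequence over
    `G_d = {x : G | d • x = 0}` of length `≥ t` contains a non-empty subsequence of length
    at most `d'` whose sum lies in `G_{d/d'}`. -/
noncomputable def etaDD (G : Type*) [AddCommGroup G] (d' d : ℕ) : ℕ :=
  sInf {t : ℕ | 0 < t ∧ ∀ S : Multiset G, (∀ g ∈ S, d • g = 0) → t ≤ Multiset.card S →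
    ∃ S' ≤ S, S' ≠ 0 ∧ Multiset.card S' ≤ d' ∧ (d / d') • S'.sum = 0}

/-- `rhoC G` : the maximum of the cross numbers of sequences over `G` containing
    no tiny zero-sum subsequence. -/
noncomputable def rhoC (G : Type*) [AddCommGroup G] : ℝ :=
  sSup {x : ℝ | ∃ S : Multiset G, (¬ ∃ S' ≤ S, IsTinyZS S') ∧ crossNum S = x}

/-- `maxPF n = P⁺(n)`, the greatest prime divisor of `n`, with `P⁺(1) = 1`. -/
def maxPF (n : ℕ) : ℕ := if n = 1 then 1 else n.primeFactors.sup id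

/-- `G` is a finite abelian group of rank `r`, i.e. `G ≅ C_{n₁} ⊕ ⋯ ⊕ C_{n_r}` with
    `1 < n₁ ∣ ⋯ ∣ n_r`. -/
def HasRank (G : Type*) [AddCommGroup G] (r : ℕ) : Prop :=
  ∃ n : Fin r → ℕ, (∀ i, 1 < n i) ∧ (∀ i j : Fin r, i ≤ j → n i ∣ n j) ∧
    Nonempty (G ≃+ ((i : Fin r) → ZMod (n i)))
theorem Multiset.exists_le_map_eq_of_le_map {α β : Type*} {f : α → β} {S : Multiset α}
    {U : Multiset β} (h : U ≤ S.map f) : ∃ T ≤ S, T.map f = U := by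
  induction S using Quotient.inductionOn with | _ l
  induction U using Quotient.inductionOn with | _ u
  obtain ⟨u', hperm, hsub⟩ := h
  obtain ⟨l', hl', rfl⟩ := List.sublist_map_iff.1 hsub
  exact ⟨l', Multiset.coe_le.2 hl'.subperm, Multiset.coe_eq_coe.2 hperm⟩

theorem crossNum_add {G : Type*} [AddCommGroup G] (S T : Multiset G) :
    crossNum (S + T) = crossNum S + crossNum T := by
  simp [crossNum]

theorem crossNum_cons {G : Type*} [AddCommGroup G] (g : G) (S : Multiset G) :
    crossNum (g ::ₘ S) = 1 / (addOrderOf g : ℝ) + crossNum S := by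
  simp [crossNum]

theorem crossNum_eq_card_div {G : Type*} [AddCommGroup G] {n : ℕ} (S : Multiset G)
    (hS : ∀ g ∈ S, addOrderOf g = n) : crossNum S = (Multiset.card S : ℝ) / n := by
  have h : (S.map fun g => (1 : ℝ) / (addOrderOf g : ℝ)) = S.map fun _ => (1 : ℝ) / n :=
    Multiset.map_congr rfl fun g hg => by rw [hS g hg]
  rw [crossNum, h, Multiset.map_const', Multiset.sum_replicate, nsmul_eq_mul]
  ring

theorem card_div_exponent_le_crossNum {G : Type*} [AddCommGroup G] [Finite G] (S : Multiset G) :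
    (Multiset.card S : ℝ) / AddMonoid.exponent G ≤ crossNum S := by
  induction S using Multiset.induction with
  | empty => simp [crossNum]
  | cons g S ih =>
    rw [crossNum_cons, Multiset.card_cons, Nat.cast_add, Nat.cast_one, add_div, add_comm]
    have h : (addOrderOf g : ℝ) ≤ AddMonoid.exponent G := by
      exact_mod_cast Nat.le_of_dvd
        (Nat.pos_of_ne_zero AddMonoid.exponent_ne_zero_of_finite)
        (AddMonoid.addOrder_dvd_exponent g)
    have h0 : (0 : ℝ) < addOrderOf g := by exact_mod_cast addOrderOf_pos g
    exact add_le_add (one_div_le_one_div_of_le h0 h) ih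

theorem IsTinyZS.card_le_exponent {G : Type*} [AddCommGroup G] [Finite G] {S : Multiset G}
    (hS : IsTinyZS S) : Multiset.card S ≤ AddMonoid.exponent G := by
  have h := (card_div_exponent_le_crossNum S).trans hS.2.2
  have h0 : (0 : ℝ) < AddMonoid.exponent G := by
    exact_mod_cast Nat.pos_of_ne_zero AddMonoid.exponent_ne_zero_of_finite
  rw [div_le_one h0] at h
  exact_mod_cast h

/-- A tiny zero-sum subsequence survives when one term is expanded into a sequence with the
same sum and no larger cross number. -/
theorem exists_isTinyZS_le_add_of_cons {G : Type*} [AddCommGroup G] {T C : Multiset G}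
    (hT : T ≠ 0) (hk : crossNum T ≤ 1 / (addOrderOf T.sum : ℝ))
    (h : ∃ U ≤ T.sum ::ₘ C, IsTinyZS U) : ∃ U ≤ T + C, IsTinyZS U := by
  obtain ⟨U, hU, hU0, hUs, hUk⟩ := h
  by_cases hm : T.sum ∈ U
  · obtain ⟨V, rfl⟩ := Multiset.exists_cons_of_mem hm
    refine ⟨T + V, add_le_add_right ((Multiset.cons_le_cons_iff _).1 hU) T, ?_, ?_, ?_⟩
    · intro h0
      exact hT (add_eq_zero.1 h0).1
    · rw [Multiset.sum_add, ← Multiset.sum_cons, hUs]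
    · rw [crossNum_add]
      rw [crossNum_cons] at hUk
      linarith
  · exact ⟨U, ((Multiset.le_cons_of_notMem hm).1 hU).trans (Multiset.le_add_left C T),
      hU0, hUs, hUk⟩

theorem exists_short_of_etaC_pos {G : Type*} [AddCommGroup G] (h : 0 < etaC G)
    (S : Multiset G) (hS : etaC G ≤ Multiset.card S) :
    ∃ T ≤ S, T ≠ 0 ∧ T.sum = 0 ∧ Multiset.card T ≤ AddMonoid.exponent G :=
  (Nat.sInf_mem (Nat.nonempty_of_pos_sInf h)).2 S hS

/-- Short zero-sum subsequences over `H` give short subsequences over `G` whose sum is killed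
by `d`, provided the image of multiplication by `d` is covered by a homomorphic image of `H`. -/
theorem exists_short_nsmul_sum_eq_zero {G H : Type*} [AddCommGroup G] [AddCommGroup H]
    (hη : 0 < etaC H) (ι : H →+ G) (d : ℕ) (A : Multiset G)
    (hA : ∀ g ∈ A, d • g ∈ ι.range) (hcard : etaC H ≤ Multiset.card A) :
    ∃ T ≤ A, T ≠ 0 ∧ d • T.sum = 0 ∧ Multiset.card T ≤ AddMonoid.exponent H := by
  classical
  choose! c hc using hA
  obtain ⟨U, hU, hU0, hUs, hUc⟩ := exists_short_of_etaC_pos hη (A.map c) (by simpa using hcard)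
  obtain ⟨T, hT, rfl⟩ := Multiset.exists_le_map_eq_of_le_map hU
  refine ⟨T, hT, by simpa using hU0, ?_, by simpa using hUc⟩
  have h : (T.map c).map ι = T.map fun g => d • g := by
    rw [Multiset.map_map]
    exact Multiset.map_congr rfl fun g hg => hc g (Multiset.mem_of_le hT hg)
  rw [← Multiset.map_id' T, ← Multiset.sum_map_nsmul, ← h, ← map_multiset_sum, hUs, ι.map_zero]

theorem exists_isTinyZS_le_add {G : Type*} [AddCommGroup G] {p j : ℕ} (hp : 2 ≤ p)
    (hshort : ∀ A : Multiset G, (∀ g ∈ A, p ^ (j + 1) • g = 0) → 3 * p - 2 ≤ Multiset.card A →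
      ∃ T ≤ A, T ≠ 0 ∧ p ^ j • T.sum = 0 ∧ Multiset.card T ≤ p)
    (htiny : ∀ B : Multiset G, (∀ g ∈ B, p ^ j • g = 0) → 3 * p ^ j - 2 ≤ Multiset.card B →
      ∃ U ≤ B, IsTinyZS U)
    (A B : Multiset G) (hA : ∀ g ∈ A, addOrderOf g = p ^ (j + 1))
    (hB : ∀ g ∈ B, p ^ j • g = 0)
    (hcard : 3 * p ^ (j + 1) ≤ Multiset.card A + p * Multiset.card B + 2) :
    ∃ U ≤ A + B, IsTinyZS U := by
  induction hn : Multiset.card A using Nat.strong_induction_on generalizing A B with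
  | _ n ih =>
  subst hn
  by_cases hc : 3 * p - 2 ≤ Multiset.card A
  · obtain ⟨T, hT, hT0, hTs, hTc⟩ := hshort A
      (fun g hg => by rw [← hA g hg]; exact addOrderOf_nsmul_eq_zero g) hc
    obtain ⟨A', rfl⟩ := Multiset.le_iff_exists_add.1 hT
    have hTpos : 0 < Multiset.card T := Multiset.card_pos.2 hT0
    have hk : crossNum T ≤ 1 / (addOrderOf T.sum : ℝ) := by
      rw [crossNum_eq_card_div T fun g hg => hA g (Multiset.mem_add.2 (Or.inl hg))]
      have hd : addOrderOf T.sum ∣ p ^ j := addOrderOf_dvd_of_nsmul_eq_zero hTs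
      have hpj : 0 < p ^ j := by positivity
      have h0 : (0 : ℝ) < addOrderOf T.sum := by
        exact_mod_cast Nat.pos_of_dvd_of_pos hd hpj
      have hle : (addOrderOf T.sum : ℝ) ≤ (p : ℝ) ^ j := by
        exact_mod_cast Nat.le_of_dvd hpj hd
      have hp0 : (0 : ℝ) < p := by positivity
      have hTc' : (Multiset.card T : ℝ) ≤ p := by exact_mod_cast hTc
      calc (Multiset.card T : ℝ) / ((p ^ (j + 1) : ℕ) : ℝ)
          ≤ (p : ℝ) / ((p ^ (j + 1) : ℕ) : ℝ) := by gcongr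
        _ = 1 / (p : ℝ) ^ j := by push_cast; field_simp; ring
        _ ≤ 1 / (addOrderOf T.sum : ℝ) := one_div_le_one_div_of_le h0 hle
    rw [add_assoc]
    refine exists_isTinyZS_le_add_of_cons hT0 hk ?_
    rw [← Multiset.add_cons]
    refine ih (Multiset.card A') ?_ A' (T.sum ::ₘ B)
      (fun g hg => hA g (Multiset.mem_add.2 (Or.inr hg))) ?_ ?_ rfl
    · rw [Multiset.card_add]
      omega
    · intro g hg
      rcases Multiset.mem_cons.1 hg with rfl | hg
      exacts [hTs, hB g hg]
    · rw [Multiset.card_add] at hcard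
      rw [Multiset.card_cons, mul_add]
      omega
  · obtain ⟨U, hU, hUt⟩ := htiny B hB (by
      by_contra hlt
      have h1 : Multiset.card B + 3 ≤ 3 * p ^ j := by omega
      have h2 := Nat.mul_le_mul_left p h1
      have h3 : p * (3 * p ^ j) = 3 * p ^ (j + 1) := by ring
      rw [h3, mul_add] at h2
      omega)
    exact ⟨U, hU.trans (Multiset.le_add_left B A), hUt⟩

theorem exists_isTinyZS_of_torsion {G : Type*} [AddCommGroup G] {p : ℕ} (hp : p.Prime)
    (hshort : ∀ (j : ℕ) (A : Multiset G), (∀ g ∈ A, p ^ (j + 1) • g = 0) →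
      3 * p - 2 ≤ Multiset.card A →
      ∃ T ≤ A, T ≠ 0 ∧ p ^ j • T.sum = 0 ∧ Multiset.card T ≤ p)
    (j : ℕ) (S : Multiset G) (hS : ∀ g ∈ S, p ^ j • g = 0)
    (hcard : 3 * p ^ j - 2 ≤ Multiset.card S) : ∃ U ≤ S, IsTinyZS U := by
  classical
  induction j generalizing S with
  | zero =>
    obtain ⟨g, hg⟩ := Multiset.card_pos_iff_exists_mem.1
      (show 0 < Multiset.card S by simp at hcard; omega)
    have h0 : g = 0 := by simpa using hS g hg
    subst h0
    exact ⟨{0}, Multiset.singleton_le.2 hg, by simp [IsTinyZS, crossNum]⟩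
  | succ j ih =>
    have hsplit := Multiset.filter_add_not (fun g => ¬ p ^ j • g = 0) S
    have hc := congrArg Multiset.card hsplit
    rw [Multiset.card_add] at hc
    rw [← hsplit]
    refine exists_isTinyZS_le_add hp.two_le (hshort j) ih _ _ ?_ ?_ ?_
    · intro g hg
      rw [Multiset.mem_filter] at hg
      have : Fact p.Prime := ⟨hp⟩
      exact addOrderOf_eq_prime_pow hg.2 (hS g hg.1)
    · intro g hg
      simpa using (Multiset.mem_filter.1 hg).2
    · have := Nat.mul_le_mul_right
        (Multiset.card (Multiset.filter (fun g => ¬ ¬ p ^ j • g = 0) S)) hp.one_le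
      omega

theorem ZMod.exists_addMonoidHom_torsion_le_range {p α : ℕ} (hp : p.Prime) (hα : 0 < α) :
    ∃ f : ZMod p →+ ZMod (p ^ α), ∀ x, p • x = 0 → x ∈ f.range := by
  obtain ⟨β, rfl⟩ : ∃ β, α = β + 1 := ⟨α - 1, by omega⟩
  have : NeZero (p ^ (β + 1)) := ⟨pow_ne_zero _ hp.ne_zero⟩
  let g : { f : ℤ →+ ZMod (p ^ (β + 1)) // f p = 0 } :=
    ⟨(AddMonoidHom.mulLeft ((p ^ β : ℕ) : ZMod (p ^ (β + 1)))).comp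
      (Int.castAddHom (ZMod (p ^ (β + 1)))), by
        have h : (p : ZMod (p ^ (β + 1))) ^ (β + 1) = 0 := by
          rw [← Nat.cast_pow, ZMod.natCast_self]
        simp [← pow_succ, h]⟩
  refine ⟨ZMod.lift p g, fun x hx => ?_⟩
  have h : ((p * x.val : ℕ) : ZMod (p ^ (β + 1))) = 0 := by
    simpa [ZMod.natCast_zmod_val] using hx
  obtain ⟨k, hk⟩ : p ^ β ∣ x.val := Nat.dvd_of_mul_dvd_mul_left hp.pos
    (by rw [← pow_succ']; exact (ZMod.natCast_eq_zero_iff _ _).1 h)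
  refine ⟨((k : ℤ) : ZMod p), ?_⟩
  rw [ZMod.lift_coe, ← ZMod.natCast_zmod_val x, hk]
  simp [g]

theorem ZMod.exists_addMonoidHom_prod_torsion_le_range {p α : ℕ} (hp : p.Prime) (hα : 0 < α) :
    ∃ f : ZMod p × ZMod p →+ ZMod (p ^ α) × ZMod (p ^ α), ∀ x, p • x = 0 → x ∈ f.range := by
  obtain ⟨f, hf⟩ := ZMod.exists_addMonoidHom_torsion_le_range hp hα
  refine ⟨f.prodMap f, fun x hx => ?_⟩
  obtain ⟨a, ha⟩ := hf x.1 (congrArg Prod.fst hx)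
  obtain ⟨b, hb⟩ := hf x.2 (congrArg Prod.snd hx)
  exact ⟨(a, b), Prod.ext ha hb⟩

theorem etaC_le_of_forall_exists_isTinyZS {G : Type*} [AddCommGroup G] [Finite G] {t : ℕ}
    (ht : 0 < t) (h : ∀ S : Multiset G, t ≤ Multiset.card S → ∃ U ≤ S, IsTinyZS U) :
    etaC G ≤ t :=
  Nat.sInf_le ⟨ht, fun S hS =>
    let ⟨U, hU, hUt⟩ := h S hS
    ⟨U, hU, hUt.1, hUt.2.1, hUt.card_le_exponent⟩⟩

/-- Assuming `η(C_m ⊕ C_n) = 2m + n - 2` for all `1 ≤ m ∣ n`, one has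
`t(C_{p^α} ⊕ C_{p^α}) = 3p^α - 2 = η(C_{p^α} ⊕ C_{p^α})` for every prime `p` and `α ≥ 1`. -/
theorem stmt10
    (heta : ∀ m n : ℕ, 0 < m → 0 < n → m ∣ n →
      etaC (ZMod m × ZMod n) = 2 * m + n - 2)
    (p : ℕ) (hp : p.Prime) (α : ℕ) (hα : 0 < α) :
    tC (ZMod (p ^ α) × ZMod (p ^ α)) = 3 * p ^ α - 2 ∧
    etaC (ZMod (p ^ α) × ZMod (p ^ α)) = 3 * p ^ α - 2 := by
  have hq : 0 < p ^ α := pow_pos hp.pos α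
  have hp2 := hp.two_le
  have : NeZero (p ^ α) := ⟨hq.ne'⟩
  have hηp : etaC (ZMod p × ZMod p) = 3 * p - 2 := by
    rw [heta p p hp.pos hp.pos dvd_rfl]
    omega
  have hηq : etaC (ZMod (p ^ α) × ZMod (p ^ α)) = 3 * p ^ α - 2 := by
    rw [heta _ _ hq hq dvd_rfl]
    omega
  refine ⟨?_, hηq⟩
  obtain ⟨ι, hι⟩ := ZMod.exists_addMonoidHom_prod_torsion_le_range hp hα
  have hexp : AddMonoid.exponent (ZMod p × ZMod p) = p := by
    simp [AddMonoid.exponent_prod, ZMod.exponent]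
  have htiny : ∀ S : Multiset (ZMod (p ^ α) × ZMod (p ^ α)),
      3 * p ^ α - 2 ≤ Multiset.card S → ∃ U ≤ S, IsTinyZS U := by
    intro S hS
    refine exists_isTinyZS_of_torsion hp (fun j A hA hc => ?_) α S
      (fun g _ => ?_) hS
    · have h := exists_short_nsmul_sum_eq_zero (by omega) ι (p ^ j) A
        (fun g hg => hι _ (by rw [← mul_nsmul, ← pow_succ]; exact hA g hg)) (by omega)
      rwa [hexp] at h
    · have h : ∀ x : ZMod (p ^ α), p ^ α • x = 0 := fun x => by
        rw [nsmul_eq_mul, ZMod.natCast_self, zero_mul]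
      exact Prod.ext (h g.1) (h g.2)
  have hmem : 3 * p ^ α - 2 ∈ {t : ℕ | 0 < t ∧ ∀ S : Multiset (ZMod (p ^ α) × ZMod (p ^ α)),
      t ≤ Multiset.card S → ∃ U ≤ S, IsTinyZS U} := ⟨by omega, htiny⟩
  have ht := Nat.sInf_mem ⟨_, hmem⟩
  exact le_antisymm (Nat.sInf_le hmem)
    (hηq.symm.le.trans (etaC_le_of_forall_exists_isTinyZS ht.1 ht.2))
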